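/- arXiv:1001.4853 — 6 statements merged into one kernel-verified Lean document; each statement's English description precedes it below -/
import Mathlib

section
/- Let ξ = exp(2πi/11) ∈ ℂ. Then ξ + ξ³ + ξ⁴ + ξ⁵ + ξ⁹ = (−1 + i·√11)/2. -/
/-- The quadratic Gauss period of order 11 is a root of `X ^ 2 + X + 3`. -/
theorem gauss_period_eleven_sq {K : Type*} [Field K] {z : K} (h : z ^ 11 = 1) (hz : z ≠ 1) :
    (2 * (z + z ^ 3 + z ^ 4 + z ^ 5 + z ^ 9) + 1) ^ 2 = -11 := by
  have hsum : 1 + z + z ^ 2 + z ^ 3 + z ^ 4 + z ^ 5 + z ^ 6 + z ^ 7 + z ^ 8 + z ^ 9 + z ^ 10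
      = 0 := by
    apply mul_left_cancel₀ (sub_ne_zero.mpr hz)
    linear_combination h
  linear_combination 12 * hsum + 4 * (z ^ 7 + 2 * z + 2 * z ^ 2 + 2 * z ^ 3) * h

open Real in
theorem gauss_period_eleven_im_pos :
    0 < sin (2 * π / 11) + sin (3 * (2 * π / 11)) + sin (4 * (2 * π / 11)) +
      sin (5 * (2 * π / 11)) + sin (9 * (2 * π / 11)) := by
  have hpi := pi_pos
  have h1 : 0 < sin (2 * π / 11) := sin_pos_of_pos_of_lt_pi (by linarith) (by linarith)
  have h4 : 0 < sin (4 * (2 * π / 11)) := sin_pos_of_pos_of_lt_pi (by linarith) (by linarith)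
  have h5 : 0 < sin (5 * (2 * π / 11)) := sin_pos_of_pos_of_lt_pi (by linarith) (by linarith)
  have h3 : sin (3 * (2 * π / 11)) = sin (5 * π / 11) := by
    rw [← sin_pi_sub]; congr 1; ring
  have h9 : sin (9 * (2 * π / 11)) = -sin (4 * π / 11) := by
    rw [← sin_sub_two_pi, ← sin_neg]; congr 1; ring
  have hlt : sin (4 * π / 11) < sin (5 * π / 11) :=
    sin_lt_sin_of_lt_of_le_pi_div_two (by linarith) (by linarith) (by linarith)
  linarith

/-- Let ξ = exp(2πi/11) ∈ ℂ. Then ξ + ξ³ + ξ⁴ + ξ⁵ + ξ⁹ = (−1 + i·√11)/2. -/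
theorem klein_gauss_sum :
    Complex.exp (2 * Real.pi * Complex.I / 11) +
      Complex.exp (2 * Real.pi * Complex.I / 11) ^ 3 +
      Complex.exp (2 * Real.pi * Complex.I / 11) ^ 4 +
      Complex.exp (2 * Real.pi * Complex.I / 11) ^ 5 +
      Complex.exp (2 * Real.pi * Complex.I / 11) ^ 9
    = (-1 + Complex.I * Real.sqrt 11) / 2 := by
  have hprim : IsPrimitiveRoot (Complex.exp (2 * Real.pi * Complex.I / 11)) 11 := by
    simpa using Complex.isPrimitiveRoot_exp 11 (by norm_num)
  have him (n : ℕ) : (Complex.exp (2 * Real.pi * Complex.I / 11) ^ n).im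
      = Real.sin (n * (2 * Real.pi / 11)) := by
    rw [← Complex.exp_nat_mul, ← Complex.exp_ofReal_mul_I_im]
    congr 2
    push_cast
    ring
  have hpos : 0 < (Complex.exp (2 * Real.pi * Complex.I / 11) +
      Complex.exp (2 * Real.pi * Complex.I / 11) ^ 3 +
      Complex.exp (2 * Real.pi * Complex.I / 11) ^ 4 +
      Complex.exp (2 * Real.pi * Complex.I / 11) ^ 5 +
      Complex.exp (2 * Real.pi * Complex.I / 11) ^ 9).im := by
    have h1 := him 1
    rw [pow_one, Nat.cast_one, one_mul] at h1
    simp only [Complex.add_im, him, h1]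
    exact_mod_cast gauss_period_eleven_im_pos
  have hsq := gauss_period_eleven_sq hprim.pow_eq_one (hprim.ne_one (by norm_num))
  generalize Complex.exp (2 * Real.pi * Complex.I / 11) +
      Complex.exp (2 * Real.pi * Complex.I / 11) ^ 3 +
      Complex.exp (2 * Real.pi * Complex.I / 11) ^ 4 +
      Complex.exp (2 * Real.pi * Complex.I / 11) ^ 5 +
      Complex.exp (2 * Real.pi * Complex.I / 11) ^ 9 = S at hpos hsq ⊢
  have hsqrt : ((Real.sqrt 11 : ℝ) : ℂ) ^ 2 = 11 := by
    exact_mod_cast Real.sq_sqrt (show (0 : ℝ) ≤ 11 by norm_num)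
  have hroots : (2 * S + 1) ^ 2 = (Complex.I * Real.sqrt 11) ^ 2 := by
    rw [hsq, mul_pow, Complex.I_sq, hsqrt]
    ring
  rcases sq_eq_sq_iff_eq_or_eq_neg.mp hroots with h | h
  · linear_combination h / 2
  · have h_im := congrArg Complex.im h
    simp at h_im
    linarith [Real.sqrt_nonneg 11]
end

section
/- The Klein cubic threefold is smooth: the only common zero in ℂ⁵ of the five partial derivatives of the polynomial F = x₁x₅² + x₅x₃² + x₃x₄² + x₄x₂² + x₂x₁² is the origin. Equivalently, there is no nonzero point z ∈ ℂ⁵ at which ∂F/∂x₁, …, ∂F/∂x₅ all vanish. -/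
open MvPolynomial

/-- The Klein cubic form F = x₁x₅² + x₅x₃² + x₃x₄² + x₄x₂² + x₂x₁²
(variables x₁,…,x₅ indexed by 0,…,4). -/
noncomputable def kleinCubicForm : MvPolynomial (Fin 5) ℂ :=
  X 0 * X 4 ^ 2 + X 4 * X 2 ^ 2 + X 2 * X 3 ^ 2 + X 3 * X 1 ^ 2 + X 1 * X 0 ^ 2

/-- In the cyclic order of the variables, the partial derivatives of the Klein cubic form
have only the trivial common zero. -/
theorem eq_zero_of_cyclic_quadrics {K : Type*} [Field K] (h33 : (33 : K) ≠ 0) {a b c d e : K}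
    (ha : b ^ 2 + 2 * e * a = 0) (hb : c ^ 2 + 2 * a * b = 0) (hc : d ^ 2 + 2 * b * c = 0)
    (hd : e ^ 2 + 2 * c * d = 0) (he : a ^ 2 + 2 * d * e = 0) :
    a = 0 ∧ b = 0 ∧ c = 0 ∧ d = 0 ∧ e = 0 := by
  have hab : a = 0 → b = 0 := by rintro rfl; simpa using ha
  have hbc : b = 0 → c = 0 := by rintro rfl; simpa using hb
  have hcd : c = 0 → d = 0 := by rintro rfl; simpa using hc
  have hde : d = 0 → e = 0 := by rintro rfl; simpa using hd
  have hea : e = 0 → a = 0 := by rintro rfl; simpa using he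
  have hprod : 33 * (a * b * c * d * e) ^ 2 = 0 := by
    have key : b ^ 2 * c ^ 2 * d ^ 2 * e ^ 2 * a ^ 2 =
        (-(2 * e * a)) * (-(2 * a * b)) * (-(2 * b * c)) * (-(2 * c * d)) * (-(2 * d * e)) := by
      rw [eq_neg_of_add_eq_zero_left ha, eq_neg_of_add_eq_zero_left hb,
        eq_neg_of_add_eq_zero_left hc, eq_neg_of_add_eq_zero_left hd,
        eq_neg_of_add_eq_zero_left he]
    linear_combination key
  have hzero : a * b * c * d * e = 0 := by simpa [h33] using hprod
  simp only [mul_eq_zero] at hzero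
  tauto

/-- The Klein cubic threefold is smooth: the only common zero in ℂ⁵ of the five
partial derivatives of F = x₁x₅² + x₅x₃² + x₃x₄² + x₄x₂² + x₂x₁² is the origin. -/
theorem klein_cubic_smooth (z : Fin 5 → ℂ)
    (h : ∀ i : Fin 5, eval z (pderiv i kleinCubicForm) = 0) :
    z = 0 := by
  have h0 := h 0
  have h1 := h 1
  have h2 := h 2
  have h3 := h 3
  have h4 := h 4
  simp [kleinCubicForm, pderiv_X] at h0 h1 h2 h3 h4
  obtain ⟨ha, hb, hc, hd, he⟩ := eq_zero_of_cyclic_quadrics (K := ℂ) (by norm_num)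
    (a := z 0) (b := z 4) (c := z 2) (d := z 3) (e := z 1)
    (by linear_combination h0) (by linear_combination h4) (by linear_combination h2)
    (by linear_combination h3) (by linear_combination h1)
  ext i
  fin_cases i <;> assumption
end

section
/- Let ξ = exp(2πi/11). Every nonzero homogeneous cubic polynomial F ∈ ℂ[x₁,…,x₅] for which there exists λ ∈ ℂ with F(ξz₁, ξ²z₂, ξ³z₃, ξ⁵z₄, ξ⁷z₅) = λ·F(z₁,…,z₅) for all z ∈ ℂ⁵ defines a singular cubic threefold: there exists a nonzero point z ∈ ℂ⁵ at which all five partial derivatives ∂F/∂x₁, …, ∂F/∂x₅ vanish. -/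
open MvPolynomial

/-- ξ = exp(2πi/11), a primitive 11th root of unity. -/
noncomputable def ξ : ℂ := Complex.exp (2 * Real.pi * Complex.I / 11)

/-- The eigenvalues (ξ, ξ², ξ³, ξ⁵, ξ⁷) of the order-11 automorphism of the p.p.a.v. X₃. -/
noncomputable def X3Diag : Fin 5 → ℂ := ![ξ, ξ ^ 2, ξ ^ 3, ξ ^ 5, ξ ^ 7]

/-- The chain rule for a diagonal rescaling of the variables. -/
lemma pderiv_bind₁_C_mul_X {σ R : Type*} [CommSemiring R] (a : σ → R) (j : σ)
    (p : MvPolynomial σ R) :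
    pderiv j (bind₁ (fun i => C (a i) * X i) p) =
      C (a j) * bind₁ (fun i => C (a i) * X i) (pderiv j p) := by
  classical
  induction p using MvPolynomial.induction_on with
  | C r => simp [algebraMap_eq]
  | add p q hp hq => simp [hp, hq, mul_add]
  | mul_X p i hp =>
    rcases eq_or_ne i j with rfl | h
    · simp [hp]
      ring
    · simp [pderiv_X_of_ne h, hp]
      ring

lemma eval_bind₁_C_mul_X {σ R : Type*} [CommSemiring R] (a z : σ → R) (p : MvPolynomial σ R) :
    eval z (bind₁ (fun i => C (a i) * X i) p) = eval (fun i => a i * z i) p := by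
  induction p using MvPolynomial.induction_on with
  | C r => simp
  | add p q hp hq => simp [hp, hq]
  | mul_X p i hp => simp [hp]

lemma eval_smul_of_isHomogeneous {σ R : Type*} [CommSemiring R] {p : MvPolynomial σ R} {n : ℕ}
    (hp : p.IsHomogeneous n) (c : R) (z : σ → R) : eval (c • z) p = c ^ n * eval z p := by
  rw [eval_eq, eval_eq, Finset.mul_sum]
  refine Finset.sum_congr rfl fun d hd => ?_
  have hdeg : ∑ i ∈ d.support, d i = n := by
    rw [← hp.degree_eq_sum_deg_support hd]
  simp only [Pi.smul_apply, smul_eq_mul, mul_pow, Finset.prod_mul_distrib,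
    Finset.prod_pow_eq_pow_sum, hdeg]
  ring

/-- A nonzero partial derivative at a coordinate point determines the eigenvalue of a homogeneous
eigenvector of a diagonal map. -/
lemma eigenvalue_eq_of_eval_pderiv_single_ne_zero {σ K : Type*} [DecidableEq σ]
    [Field K] [Infinite K] {F : MvPolynomial σ K} {n : ℕ}
    (hF : F.IsHomogeneous (n + 1)) {a : σ → K} {lam : K}
    (heig : ∀ z : σ → K, eval (fun i => a i * z i) F = lam * eval z F) {i j : σ}
    (h : eval (Pi.single i 1) (pderiv j F) ≠ 0) : lam = a i ^ n * a j := by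
  have hpoly : bind₁ (fun i => C (a i) * X i) F = C lam * F := by
    refine MvPolynomial.funext fun z => ?_
    simpa [eval_bind₁_C_mul_X] using heig z
  have hder := congrArg (fun p => eval (Pi.single i 1) (pderiv j p)) hpoly
  simp only [pderiv_bind₁_C_mul_X, pderiv_C_mul, map_mul, eval_C] at hder
  have hscale : eval (Pi.single i 1)
      (bind₁ (fun i => C (a i) * X i) (pderiv j F)) =
      a i ^ n * eval (Pi.single i 1) (pderiv j F) := by
    have hhom : (pderiv j F).IsHomogeneous n := hF.pderiv
    have hpt : (fun k => a k * (Pi.single i 1 : σ → K) k) = a i • Pi.single i 1 := by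
      ext k
      rcases eq_or_ne k i with rfl | hk <;> simp [*]
    rw [eval_bind₁_C_mul_X, hpt, eval_smul_of_isHomogeneous hhom]
  rw [hscale] at hder
  refine (mul_right_cancel₀ h ?_).symm
  rw [← hder]
  ring

lemma isPrimitiveRoot_ξ : IsPrimitiveRoot ξ 11 := by
  simpa [ξ] using Complex.isPrimitiveRoot_exp 11 (by norm_num)

/-- every nonzero homogeneous cubic F ∈ ℂ[x₁,…,x₅] which is an eigenvector for
(z₁,…,z₅) ↦ (ξz₁, ξ²z₂, ξ³z₃, ξ⁵z₄, ξ⁷z₅) defines a singular cubic threefold: all five partial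
derivatives of F vanish at some nonzero point of ℂ⁵. -/
theorem X3_eigencubics_singular (F : MvPolynomial (Fin 5) ℂ) (hF : F ≠ 0)
    (hhom : F.IsHomogeneous 3)
    (heig : ∃ lam : ℂ, ∀ z : Fin 5 → ℂ, eval (fun i => X3Diag i * z i) F = lam * eval z F) :
    ∃ z : Fin 5 → ℂ, z ≠ 0 ∧ ∀ i : Fin 5, eval z (pderiv i F) = 0 := by
  obtain ⟨lam, heig⟩ := heig
  by_contra! hsmooth
  have hlam : ∀ i, ∃ j, lam = X3Diag i ^ 2 * X3Diag j := fun i =>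
    (hsmooth (Pi.single i 1) (by simp)).imp fun _ =>
      eigenvalue_eq_of_eval_pderiv_single_ne_zero hhom heig
  let w : Fin 5 → ℕ := ![1, 2, 3, 5, 7]
  have hdiag : ∀ i, X3Diag i = ξ ^ w i := by
    intro i
    fin_cases i <;> simp [X3Diag, w]
  choose j hj using hlam
  have hmod : ∀ i, 2 * w i + w (j i) ≡ 2 * w 0 + w (j 0) [MOD 11] := by
    intro i
    have h := (hj i).symm.trans (hj 0)
    simp only [hdiag, ← pow_mul', ← pow_add] at h
    rwa [(isPrimitiveRoot_ξ.isOfFinOrder (by norm_num)).pow_eq_pow_iff_modEq,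
      ← isPrimitiveRoot_ξ.eq_orderOf] at h
  have hcontra : ∀ a b c d e : Fin 5, ¬ (2 * w 1 + w b ≡ 2 * w 0 + w a [MOD 11] ∧
      2 * w 2 + w c ≡ 2 * w 0 + w a [MOD 11] ∧ 2 * w 3 + w d ≡ 2 * w 0 + w a [MOD 11] ∧
      2 * w 4 + w e ≡ 2 * w 0 + w a [MOD 11]) := by
    decide
  exact hcontra _ _ _ _ _ ⟨hmod 1, hmod 2, hmod 3, hmod 4⟩
end

section
/- Let μ = exp(2πi/7). Every nonzero homogeneous cubic polynomial F ∈ ℂ[x₁,…,x₅] for which there exists λ ∈ ℂ with F(μz₁, μ²z₂, μ³z₃, z₄, z₅) = λ·F(z₁,…,z₅) for all z ∈ ℂ⁵ defines a singular cubic threefold: there exists a nonzero point z ∈ ℂ⁵ at which all five partial derivatives of F vanish. -/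
open MvPolynomial

/-- μ = exp(2πi/7), a primitive 7th root of unity. -/
noncomputable def μ : ℂ := Complex.exp (2 * Real.pi * Complex.I / 7)

/-- The eigenvalues (μ, μ², μ³, 1, 1) of the order-7 case with eigenvalues (μ, μ², μ³, 1, 1). -/
noncomputable def mu7Diag1 : Fin 5 → ℂ := ![μ, μ ^ 2, μ ^ 3, 1, 1]

namespace MvPolynomial

variable {σ R : Type*} [CommSemiring R]

/-- The coefficients of a polynomial after scaling each variable `X i` by `d i`. -/
theorem coeff_aeval_C_mul_X [Fintype σ] (d : σ → R) (F : MvPolynomial σ R) (m : σ →₀ ℕ) :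
    coeff m (aeval (fun i => C (d i) * X i : σ → MvPolynomial σ R) F) =
      (∏ i, d i ^ m i) * coeff m F := by
  classical
  induction F using MvPolynomial.induction_on' with
  | add p q hp hq => simp only [map_add, coeff_add, hp, hq, mul_add]
  | monomial n a =>
    have h : aeval (fun i => C (d i) * X i : σ → MvPolynomial σ R) (monomial n a) =
        monomial n ((∏ i, d i ^ n i) * a) := by
      rw [aeval_monomial, Finsupp.prod_fintype _ _ (fun i => pow_zero _)]
      simp only [mul_pow, Finset.prod_mul_distrib, algebraMap_eq, ← C_pow]
      rw [← map_prod, monomial_eq, Finsupp.prod_fintype _ _ (fun i => pow_zero _), C_mul]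
      ring
    rw [h, coeff_monomial, coeff_monomial]
    split_ifs with hnm
    · rw [hnm]
    · rw [mul_zero]

/-- If scaling the variables by `d` multiplies `F` by `c`, then every monomial of `F` is scaled
by `c`. -/
theorem prod_pow_eq_of_coeff_ne_zero {K : Type*} [Field K] [Infinite K] [Fintype σ]
    {d : σ → K} {F : MvPolynomial σ K} {c : K}
    (h : ∀ z : σ → K, eval (fun i => d i * z i) F = c * eval z F) {m : σ →₀ ℕ}
    (hm : coeff m F ≠ 0) : ∏ i, d i ^ m i = c := by
  have hF : aeval (fun i => C (d i) * X i : σ → MvPolynomial σ K) F = C c * F := by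
    refine MvPolynomial.funext fun z => ?_
    rw [map_mul, eval_C, ← h z, map_aeval]
    simp only [map_mul, eval_C, eval_X]
    congr 2
    ext
    simp
  have := coeff_aeval_C_mul_X d F m
  rw [hF, coeff_C_mul] at this
  exact (mul_right_cancel₀ hm this).symm

/-- The value of a form of degree `n` at the `i`-th coordinate point is its coefficient at
`X i ^ n`. -/
theorem IsHomogeneous.eval_single_one [Fintype σ] [DecidableEq σ] {G : MvPolynomial σ R} {n : ℕ}
    (hG : G.IsHomogeneous n) (i : σ) :
    eval (Pi.single i 1) G = coeff (Finsupp.single i n) G := by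
  rw [eval_eq', Finset.sum_eq_single (Finsupp.single i n)]
  · rw [Finset.prod_eq_one, mul_one]
    intro j _
    rcases eq_or_ne j i with rfl | hj
    · simp
    · simp [Finsupp.single_eq_of_ne hj]
  · intro m hm hmn
    suffices ∃ j, j ≠ i ∧ m j ≠ 0 by
      obtain ⟨j, hj, hmj⟩ := this
      rw [Finset.prod_eq_zero (Finset.mem_univ j), mul_zero]
      rw [Pi.single_eq_of_ne hj, zero_pow hmj]
    by_contra! hall
    have hm' : m = Finsupp.single i (m i) := by
      ext j
      rcases eq_or_ne j i with rfl | hj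
      · simp
      · rw [hall j hj, Finsupp.single_eq_of_ne hj]
    have hdeg := hG (mem_support_iff.mp hm)
    rw [hm'] at hdeg
    have hn : m i = n := by simpa [Finsupp.weight_single] using hdeg
    exact hmn (hn ▸ hm')
  · intro hm
    rw [notMem_support_iff.mp hm, zero_mul]

end MvPolynomial

theorem isPrimitiveRoot_μ : IsPrimitiveRoot μ 7 := by
  simpa [μ] using Complex.isPrimitiveRoot_exp 7 (by norm_num)

theorem mod_seven_eq_of_μ_pow_eq {a b : ℕ} (h : μ ^ a = μ ^ b) : a % 7 = b % 7 := by
  refine isPrimitiveRoot_μ.pow_inj (Nat.mod_lt _ (by norm_num)) (Nat.mod_lt _ (by norm_num)) ?_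
  rwa [← pow_eq_pow_mod _ isPrimitiveRoot_μ.pow_eq_one,
    ← pow_eq_pow_mod _ isPrimitiveRoot_μ.pow_eq_one]

theorem mu7Diag1_eq_pow (i : Fin 5) : mu7Diag1 i = μ ^ (![1, 2, 3, 0, 0] i : ℕ) := by
  fin_cases i <;> simp [mu7Diag1]

/-- every nonzero homogeneous cubic F ∈ ℂ[x₁,…,x₅] which is an eigenvector for
(z₁,…,z₅) ↦ (μz₁, μ²z₂, μ³z₃, z₄, z₅) defines a singular cubic threefold: all five partial
derivatives of F vanish at some nonzero point of ℂ⁵. -/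
theorem order7_case1_eigencubics_singular (F : MvPolynomial (Fin 5) ℂ) (hF : F ≠ 0)
    (hhom : F.IsHomogeneous 3)
    (heig : ∃ lam : ℂ, ∀ z : Fin 5 → ℂ, eval (fun i => mu7Diag1 i * z i) F = lam * eval z F) :
    ∃ z : Fin 5 → ℂ, z ≠ 0 ∧ ∀ i : Fin 5, eval z (pderiv i F) = 0 := by
  obtain ⟨c, hc⟩ := heig
  by_contra! hsmooth
  have key (i : Fin 5) : ∃ j, c = μ ^ (2 * ![1, 2, 3, 0, 0] i + ![1, 2, 3, 0, 0] j : ℕ) := by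
    obtain ⟨j, hj⟩ := hsmooth (Pi.single i 1) (by simp)
    rw [(hhom.pderiv (i := j)).eval_single_one, coeff_pderiv] at hj
    refine ⟨j, ?_⟩
    rw [← prod_pow_eq_of_coeff_ne_zero hc (left_ne_zero_of_mul hj)]
    simp only [Finsupp.add_apply, pow_add, Finset.prod_mul_distrib, Finsupp.single_apply,
      pow_ite, pow_zero, pow_one, Finset.prod_ite_eq, Finset.mem_univ, if_true,
      mu7Diag1_eq_pow, ← pow_mul]
    ring
  obtain ⟨j₀, h₀⟩ := key 0
  obtain ⟨j₁, h₁⟩ := key 1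
  obtain ⟨j₂, h₂⟩ := key 2
  have h₀₁ := mod_seven_eq_of_μ_pow_eq (h₀.symm.trans h₁)
  have h₀₂ := mod_seven_eq_of_μ_pow_eq (h₀.symm.trans h₂)
  revert h₀₁ h₀₂
  clear * -
  revert j₀ j₁ j₂
  decide
end

section
/- Let C be the 4×4 matrix over the field 𝔽₁₁ = ℤ/11ℤ with rows (0, 0, 0, −1), (1, 0, 0, 4), (0, 1, 0, 5), (0, 0, 1, 4), acting on the column space 𝔽₁₁⁴, and let w₁ = (−1, 3, −3, 1), w₂ = (1, −2, 1, 0), w₃ = (−1, 1, 0, 0), w₄ = (1, 0, 0, 0) in 𝔽₁₁⁴. Then the 𝔽₁₁-subspaces of 𝔽₁₁⁴ invariant under C are exactly the five subspaces W₀ = {0}, W₁ = span(w₁), W₂ = span(w₁, w₂), W₃ = span(w₁, w₂, w₃), and W₄ = 𝔽₁₁⁴. -/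
/-- The matrix of the induced action of the order-11 automorphism on Λ₄/Λ₀ ≅ 𝔽₁₁⁴. -/
def Cmat : Matrix (Fin 4) (Fin 4) (ZMod 11) :=
  !![0, 0, 0, -1;
     1, 0, 0, 4;
     0, 1, 0, 5;
     0, 0, 1, 4]

def w₁ : Fin 4 → ZMod 11 := ![-1, 3, -3, 1]
def w₂ : Fin 4 → ZMod 11 := ![1, -2, 1, 0]
def w₃ : Fin 4 → ZMod 11 := ![-1, 1, 0, 0]

section JordanChain

variable {K V : Type*} [Field K] [AddCommGroup V] [Module K V]

/-- The span of the first `k` vectors of a sequence. -/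
def chainSpan (K : Type*) {V : Type*} [Field K] [AddCommGroup V] [Module K V]
    (v : ℕ → V) (k : ℕ) : Submodule K V :=
  Submodule.span K (v '' Set.Iio k)

theorem chainSpan_zero (v : ℕ → V) : chainSpan K v 0 = ⊥ := by
  simp [chainSpan]

theorem chainSpan_succ (v : ℕ → V) (k : ℕ) :
    chainSpan K v (k + 1) = chainSpan K v k ⊔ Submodule.span K {v k} := by
  have h : Set.Iio (k + 1) = insert k (Set.Iio k) := by
    ext i
    simp only [Set.mem_Iio, Set.mem_insert_iff]
    omega
  rw [chainSpan, chainSpan, h, Set.image_insert_eq, Submodule.span_insert, sup_comm]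

theorem mem_chainSpan_succ {v : ℕ → V} {k : ℕ} {x : V} :
    x ∈ chainSpan K v (k + 1) ↔ ∃ y ∈ chainSpan K v k, ∃ c : K, y + c • v k = x := by
  simp [chainSpan_succ, Submodule.mem_sup, Submodule.mem_span_singleton]

variable {N : V →ₗ[K] V} {v : ℕ → V} {n : ℕ}

theorem map_mem_chainSpan (h0 : N (v 0) = 0) (hN : ∀ k, k + 1 < n → N (v (k + 1)) = v k) :
    ∀ k < n, ∀ x ∈ chainSpan K v (k + 1), N x ∈ chainSpan K v k := by
  intro k hk x hx
  refine (Submodule.span_le (p := (chainSpan K v k).comap N)).2 ?_ hx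
  rintro _ ⟨i, hi, rfl⟩
  rw [Set.mem_Iio] at hi
  rw [SetLike.mem_coe, Submodule.mem_comap]
  cases i with
  | zero => simp [h0]
  | succ j =>
    rw [hN j (by omega)]
    exact Submodule.subset_span ⟨j, Set.mem_Iio.2 (by omega), rfl⟩

theorem map_mem_chainSpan_self (h0 : N (v 0) = 0)
    (hN : ∀ k, k + 1 < n → N (v (k + 1)) = v k) {k : ℕ} (hk : k ≤ n) :
    ∀ x ∈ chainSpan K v k, N x ∈ chainSpan K v k := by
  intro x hx
  cases k with
  | zero =>
    rw [chainSpan_zero, Submodule.mem_bot] at hx ⊢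
    rw [hx, map_zero]
  | succ j =>
    exact mem_chainSpan_succ.2 ⟨N x, map_mem_chainSpan h0 hN j hk x hx, 0, by simp⟩

theorem chainSpan_le_of_mem (h0 : N (v 0) = 0) (hN : ∀ k, k + 1 < n → N (v (k + 1)) = v k)
    {W : Submodule K V} (hW : ∀ x ∈ W, N x ∈ W) {k : ℕ} (hk : k < n) {y : V}
    (hy : y ∈ chainSpan K v k) {c : K} (hc : c ≠ 0) (h : y + c • v k ∈ W) :
    chainSpan K v (k + 1) ≤ W := by
  induction k generalizing y with
  | zero =>
    rw [chainSpan_zero, Submodule.mem_bot] at hy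
    rw [hy, zero_add, W.smul_mem_iff hc] at h
    simpa [chainSpan_succ, chainSpan_zero] using h
  | succ j ih =>
    have hNy := map_mem_chainSpan h0 hN j (by omega) y hy
    have hle : chainSpan K v (j + 1) ≤ W := by
      refine ih (by omega) hNy ?_
      have := hW _ h
      rwa [map_add, map_smul, hN j hk] at this
    rw [W.add_mem_iff_right (hle hy), W.smul_mem_iff hc] at h
    rw [chainSpan_succ]
    exact sup_le hle ((Submodule.span_singleton_le_iff_mem _ _).2 h)

/-- The invariant subspaces of a single nilpotent Jordan block are the spans of the initial
segments of its Jordan chain. -/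
theorem exists_eq_chainSpan (h0 : N (v 0) = 0) (hN : ∀ k, k + 1 < n → N (v (k + 1)) = v k)
    {W : Submodule K V} (hW : ∀ x ∈ W, N x ∈ W) {m : ℕ} (hm : m ≤ n)
    (hle : W ≤ chainSpan K v m) : ∃ k ≤ m, W = chainSpan K v k := by
  induction m with
  | zero => exact ⟨0, le_rfl, le_antisymm hle (by simp [chainSpan_zero])⟩
  | succ m ih =>
    by_cases h : W ≤ chainSpan K v m
    · obtain ⟨k, hk, rfl⟩ := ih (by omega) h
      exact ⟨k, by omega, rfl⟩
    · obtain ⟨x, hxW, hx⟩ := SetLike.not_le_iff_exists.1 h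
      obtain ⟨y, hy, c, rfl⟩ := mem_chainSpan_succ.1 (hle hxW)
      have hc : c ≠ 0 := by
        rintro rfl
        exact hx (by simpa using hy)
      exact ⟨m + 1, le_rfl, le_antisymm hle (chainSpan_le_of_mem h0 hN hW hm hy hc hxW)⟩

end JordanChain

/-- The Jordan chain of `Cmat - 1`, extended by zero. -/
def jordanChain : ℕ → Fin 4 → ZMod 11
  | 0 => w₁
  | 1 => w₂
  | 2 => w₃
  | 3 => ![1, 0, 0, 0]
  | _ => 0

theorem jordanChain_zero : (Cmat - 1).mulVecLin (jordanChain 0) = 0 := by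
  rw [Matrix.mulVecLin_apply]
  decide

theorem jordanChain_succ :
    ∀ k, k + 1 < 4 → (Cmat - 1).mulVecLin (jordanChain (k + 1)) = jordanChain k := by
  intro k hk
  rw [Matrix.mulVecLin_apply]
  have : k < 3 := by omega
  interval_cases k <;> decide

theorem prime_eleven_fact : Fact (Nat.Prime 11) := ⟨by norm_num⟩

section

attribute [local instance] prime_eleven_fact

theorem chainSpan_jordanChain_one :
    chainSpan (ZMod 11) jordanChain 1 = Submodule.span (ZMod 11) {w₁} := by
  simp [chainSpan_succ, chainSpan_zero, jordanChain]

theorem chainSpan_jordanChain_two :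
    chainSpan (ZMod 11) jordanChain 2 = Submodule.span (ZMod 11) {w₁, w₂} := by
  rw [chainSpan_succ, chainSpan_jordanChain_one, Submodule.span_insert, jordanChain]

theorem chainSpan_jordanChain_three :
    chainSpan (ZMod 11) jordanChain 3 = Submodule.span (ZMod 11) {w₁, w₂, w₃} := by
  rw [chainSpan_succ, chainSpan_jordanChain_two, Submodule.span_insert, Submodule.span_insert,
    Submodule.span_insert, jordanChain, sup_assoc]

theorem chainSpan_jordanChain_four : chainSpan (ZMod 11) jordanChain 4 = ⊤ := by
  refine eq_top_iff.2 fun x _ => ?_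
  have hx : x = x 3 • jordanChain 0 + (x 2 + 3 * x 3) • jordanChain 1
      + (x 1 + 2 * x 2 + 3 * x 3) • jordanChain 2
      + (x 0 + x 1 + x 2 + x 3) • jordanChain 3 := by
    funext i
    fin_cases i <;> simp [jordanChain, w₁, w₂, w₃] <;> ring
  have hmem (i : ℕ) (hi : i < 4) : jordanChain i ∈ chainSpan (ZMod 11) jordanChain 4 :=
    Submodule.subset_span ⟨i, hi, rfl⟩
  rw [hx]
  exact add_mem (add_mem (add_mem (Submodule.smul_mem _ _ (hmem 0 (by norm_num)))
    (Submodule.smul_mem _ _ (hmem 1 (by norm_num))))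
    (Submodule.smul_mem _ _ (hmem 2 (by norm_num))))
    (Submodule.smul_mem _ _ (hmem 3 (by norm_num)))

end

theorem Cmat_mulVec_mem_iff {W : Submodule (ZMod 11) (Fin 4 → ZMod 11)} :
    (∀ x ∈ W, Cmat.mulVec x ∈ W) ↔ ∀ x ∈ W, (Cmat - 1).mulVecLin x ∈ W := by
  refine forall₂_congr fun x hx => ?_
  rw [Matrix.mulVecLin_apply, Matrix.sub_mulVec, Matrix.one_mulVec, W.sub_mem_iff_left hx]

/-- the C-invariant 𝔽₁₁-subspaces of 𝔽₁₁⁴ are exactly {0}, span(w₁),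
span(w₁,w₂), span(w₁,w₂,w₃) and 𝔽₁₁⁴. -/
theorem Cmat_invariant_subspaces (W : Submodule (ZMod 11) (Fin 4 → ZMod 11)) :
    (∀ x ∈ W, Cmat.mulVec x ∈ W) ↔
      (W = ⊥ ∨ W = Submodule.span (ZMod 11) {w₁} ∨
        W = Submodule.span (ZMod 11) {w₁, w₂} ∨
        W = Submodule.span (ZMod 11) {w₁, w₂, w₃} ∨ W = ⊤) := by
  have := prime_eleven_fact
  rw [Cmat_mulVec_mem_iff, ← chainSpan_zero jordanChain, ← chainSpan_jordanChain_one,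
    ← chainSpan_jordanChain_two, ← chainSpan_jordanChain_three, ← chainSpan_jordanChain_four]
  constructor
  · intro hW
    obtain ⟨k, hk, rfl⟩ := exists_eq_chainSpan jordanChain_zero jordanChain_succ hW le_rfl
      (chainSpan_jordanChain_four ▸ le_top)
    interval_cases k <;> simp
  · rintro (rfl | rfl | rfl | rfl | rfl) <;>
      exact map_mem_chainSpan_self jordanChain_zero jordanChain_succ (by norm_num)
end

section
/- Let ξ = exp(2πi/11), ν = (−1+i√11)/2, for k ∈ ℤ let v_k = (ξ^k, ξ^{9k}, ξ^{3k}, ξ^{4k}, ξ^{5k}) ∈ ℂ⁵, and set u₁ = (v₀−3v₁+3v₂−v₃)/(1+2ν), u₂ = (v₁−3v₂+3v₃−v₄)/(1+2ν), u₃ = v₀, u₄ = v₁, u₅ = v₂. Let U be the 5×5 complex matrix whose columns are u₁, …, u₅; then U is invertible, and let y₁, …, y₅ ∈ ℂ⁵ be the rows of U⁻¹. Define the Hermitian pairing ⟨a,b⟩ = a₁·conj(b₁) + … + a₅·conj(b₅) and Q(a,b) = ⟨a,a⟩·⟨b,b⟩ − ⟨a,b⟩·⟨b,a⟩ for a, b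 ∈ ℂ⁵ (so Q(a,b) is real). Let L be the list of 25 vectors consisting of y_k for 1 ≤ k ≤ 5, y_k + y_l for 1 ≤ k < l ≤ 5, and y_k + ν·y_l for 1 ≤ k < l ≤ 5. Then the determinant of the 25×25 real matrix (Q(ℓ_i, ℓ_j))_{ℓ_i, ℓ_j ∈ L} equals 2²·11¹⁰. -/
/-- ν = (−1 + i√11)/2. -/
noncomputable def ν : ℂ := (-1 + Complex.I * Real.sqrt 11) / 2

/-- ℤ[ν] = {a + bν : a, b ∈ ℤ} ⊂ ℂ. -/
noncomputable def Zν : Set ℂ := {z | ∃ a b : ℤ, z = (a : ℂ) + (b : ℂ) * ν}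

/-- v_k = (ξ^k, ξ^{9k}, ξ^{3k}, ξ^{4k}, ξ^{5k}) ∈ ℂ⁵. -/
noncomputable def v (k : ℕ) : Fin 5 → ℂ := fun i => ξ ^ (k * ![1, 9, 3, 4, 5] i)

/-- u₁ = (v₀ − 3v₁ + 3v₂ − v₃)/(1+2ν). -/
noncomputable def u₁ : Fin 5 → ℂ :=
  (1 / (1 + 2 * ν)) • (v 0 - (3 : ℂ) • v 1 + (3 : ℂ) • v 2 - v 3)

/-- u₂ = (v₁ − 3v₂ + 3v₃ − v₄)/(1+2ν). -/
noncomputable def u₂ : Fin 5 → ℂ :=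
  (1 / (1 + 2 * ν)) • (v 1 - (3 : ℂ) • v 2 + (3 : ℂ) • v 3 - v 4)

/-- The matrix U whose columns are u₁, u₂, u₃ = v₀, u₄ = v₁, u₅ = v₂. -/
noncomputable def U : Matrix (Fin 5) (Fin 5) ℂ :=
  Matrix.of fun i j : Fin 5 => ![u₁, u₂, v 0, v 1, v 2] j i

/-- y₁, …, y₅: the rows of U⁻¹ (the dual basis of u₁, …, u₅). -/
noncomputable def y (k : Fin 5) : Fin 5 → ℂ := fun i => U⁻¹ k i

/-- The Hermitian pairing ⟨a,b⟩ = a₁conj(b₁) + … + a₅conj(b₅). -/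
noncomputable def herm (a b : Fin 5 → ℂ) : ℂ := ∑ i : Fin 5, a i * (starRingEnd ℂ) (b i)

/-- Q(a,b) = ⟨a,a⟩⟨b,b⟩ − ⟨a,b⟩⟨b,a⟩ (a real number, realized as the real part). -/
noncomputable def Q (a b : Fin 5 → ℂ) : ℝ := (herm a a * herm b b - herm a b * herm b a).re

/-- The 25 vectors, indexed by (k,l) ∈ Fin 5 × Fin 5: y_k for k = l; y_k + y_l for k < l;
and y_l + ν·y_k for k > l (the pair (l,k) with l < k). -/
noncomputable def L (k l : Fin 5) : Fin 5 → ℂ :=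
  if k = l then y k else if k < l then y k + y l else y l + ν • y k

open Matrix

namespace KleinFano

/-- The field `ℚ(ν)`, where `ν² = -3 - ν`. -/
abbrev K : Type := QuadraticAlgebra ℚ (-3) (-1)

lemma sqrt_eleven_sq : ((Real.sqrt 11 : ℝ) : ℂ) ^ 2 = 11 := by
  rw [← Complex.ofReal_pow, Real.sq_sqrt (by norm_num)]
  norm_num

lemma ν_mul_self : ν * ν = -3 - ν := by
  unfold ν
  linear_combination (Complex.I ^ 2 / 4) * sqrt_eleven_sq + (11 / 4) * Complex.I_sq

lemma conj_ν : (starRingEnd ℂ) ν = -1 - ν := by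
  simp only [ν, map_div₀, map_add, map_neg, map_one, map_mul, Complex.conj_I,
    Complex.conj_ofReal, map_ofNat]
  ring

lemma ν_re : ν.re = -1 / 2 := by
  simp [ν]

/-- The embedding of `ℚ(ν)` into `ℂ`. -/
noncomputable def φ : K →+* ℂ where
  toFun z := (z.re : ℂ) + (z.im : ℂ) * ν
  map_one' := by
    change ((1 : ℚ) : ℂ) + ((0 : ℚ) : ℂ) * ν = 1
    simp
  map_zero' := by simp
  map_add' x y := by simp; ring
  map_mul' x y := by
    simp
    linear_combination (-(x.im : ℂ) * y.im) * ν_mul_self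

lemma φ_apply (z : K) : φ z = (z.re : ℂ) + (z.im : ℂ) * ν := rfl

lemma φ_star (z : K) : φ (star z) = star (φ z) := by
  simp [φ_apply, conj_ν]
  ring

lemma φ_re (z : K) : (φ z).re = ((z.re - z.im / 2 : ℚ) : ℝ) := by
  simp [φ_apply, ν_re]
  ring

lemma ξ_pow_eleven : ξ ^ 11 = 1 := by
  rw [ξ, ← Complex.exp_nat_mul]
  convert Complex.exp_two_pi_mul_I using 2
  push_cast
  ring

lemma ξ_isPrimitiveRoot : IsPrimitiveRoot ξ 11 := by
  simpa [ξ] using Complex.isPrimitiveRoot_exp 11 (by norm_num)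

lemma conj_ξ : (starRingEnd ℂ) ξ = ξ ^ 10 := by
  have h : (starRingEnd ℂ) ξ * ξ = 1 := by
    rw [mul_comm, Complex.mul_conj, Complex.normSq_eq_norm_sq,
      ξ_isPrimitiveRoot.norm'_eq_one (by norm_num)]
    simp
  linear_combination ξ ^ 10 * h - (starRingEnd ℂ) ξ * ξ_pow_eleven

lemma ξ_pow_im (k : ℕ) : (ξ ^ k).im = Real.sin (k * (2 * Real.pi / 11)) := by
  rw [ξ, ← Complex.exp_nat_mul, ← Complex.exp_ofReal_mul_I_im]
  congr 2
  push_cast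
  ring

lemma sum_ξ_pow_range :
    1 + ξ + ξ ^ 2 + ξ ^ 3 + ξ ^ 4 + ξ ^ 5 + ξ ^ 6 + ξ ^ 7 + ξ ^ 8 + ξ ^ 9 + ξ ^ 10 = 0 := by
  simpa [Finset.sum_range_succ] using ξ_isPrimitiveRoot.geom_sum_eq_zero (by norm_num)

/-- The quadratic Gaussian period of `ξ`. -/
lemma gaussian_period : ξ + ξ ^ 9 + ξ ^ 3 + ξ ^ 4 + ξ ^ 5 = ν := by
  set s := ξ + ξ ^ 9 + ξ ^ 3 + ξ ^ 4 + ξ ^ 5 with hs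
  have h0 := sum_ξ_pow_range
  have h1 : s * s = -3 - s := by
    rw [hs]
    linear_combination 3 * h0 + (ξ ^ 7 + 2 * ξ + 2 * ξ ^ 2 + 2 * ξ ^ 3) * ξ_pow_eleven
  have h2 : (s - ν) * (s - (-1 - ν)) = 0 := by
    linear_combination h1 - ν_mul_self
  rcases mul_eq_zero.mp h2 with h | h
  · exact sub_eq_zero.mp h
  · exfalso
    have h3 : s.im = -(Real.sqrt 11 / 2) := by
      rw [sub_eq_zero.mp h]
      simp [ν]
    have h4 : s.im < 0 := by rw [h3]; simp
    have h5 : s.im = Real.sin (1 * (2 * Real.pi / 11)) + Real.sin (9 * (2 * Real.pi / 11))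
        + Real.sin (3 * (2 * Real.pi / 11)) + Real.sin (4 * (2 * Real.pi / 11))
        + Real.sin (5 * (2 * Real.pi / 11)) := by
      have := ξ_pow_im 1
      simp only [pow_one] at this
      simp only [hs, Complex.add_im, ξ_pow_im, this]
      norm_num
    have hpi := Real.pi_pos
    have p1 : 0 < Real.sin (1 * (2 * Real.pi / 11)) :=
      Real.sin_pos_of_pos_of_lt_pi (by linarith) (by linarith)
    have p4 : 0 < Real.sin (4 * (2 * Real.pi / 11)) :=
      Real.sin_pos_of_pos_of_lt_pi (by linarith) (by linarith)
    have p5 : 0 < Real.sin (5 * (2 * Real.pi / 11)) :=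
      Real.sin_pos_of_pos_of_lt_pi (by linarith) (by linarith)
    have p9 : Real.sin (9 * (2 * Real.pi / 11)) = -Real.sin (4 * Real.pi / 11) := by
      rw [show 9 * (2 * Real.pi / 11) = 2 * Real.pi - 4 * Real.pi / 11 by ring,
        Real.sin_two_pi_sub]
    have p3 : Real.sin (3 * (2 * Real.pi / 11)) = Real.sin (5 * Real.pi / 11) := by
      rw [← Real.sin_pi_sub]
      congr 1
      ring
    have p : Real.sin (4 * Real.pi / 11) < Real.sin (5 * Real.pi / 11) :=
      Real.sin_lt_sin_of_lt_of_le_pi_div_two (by linarith) (by linarith) (by linarith)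
    linarith

/-- The value of `∑ ξ ^ (m * c)`, for `c` ranging over the nonzero squares modulo `11`. -/
def period (m : ℕ) : K :=
  if m % 11 = 0 then ⟨5, 0⟩ else if m % 11 ∈ [1, 3, 4, 5, 9] then ⟨0, 1⟩ else ⟨-1, -1⟩

lemma sum_ξ_pow (m : ℕ) :
    ∑ i : Fin 5, ξ ^ (m * ![1, 9, 3, 4, 5] i) = φ (period m) := by
  have h0 := sum_ξ_pow_range
  have h1 := gaussian_period
  have red (c : ℕ) : ξ ^ (m * c) = ξ ^ (m % 11 * c % 11) := by
    rw [pow_eq_pow_mod _ ξ_pow_eleven, Nat.mod_mul_mod]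
  have hm : m % 11 < 11 := Nat.mod_lt _ (by norm_num)
  simp only [red, period]
  generalize m % 11 = r at hm
  interval_cases r <;> simp [Fin.sum_univ_five, φ_apply] <;>
    first
    | linear_combination h1
    | linear_combination h0 - h1

/-- The matrix with columns `v 0, …, v 4`. -/
noncomputable def V : Matrix (Fin 5) (Fin 5) ℂ := of fun i j : Fin 5 => v j i

/-- The matrix expressing `u₁, …, u₅` in terms of `v 0, …, v 4`. -/
def S : Matrix (Fin 5) (Fin 5) K :=
  !![⟨-1 / 11, -2 / 11⟩, 0, ⟨1, 0⟩, 0, 0;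
     ⟨3 / 11, 6 / 11⟩, ⟨-1 / 11, -2 / 11⟩, 0, ⟨1, 0⟩, 0;
     ⟨-3 / 11, -6 / 11⟩, ⟨3 / 11, 6 / 11⟩, 0, 0, ⟨1, 0⟩;
     ⟨1 / 11, 2 / 11⟩, ⟨-3 / 11, -6 / 11⟩, 0, 0, 0;
     0, ⟨1 / 11, 2 / 11⟩, 0, 0, 0]

/-- The Gram matrix of `y₁, …, y₅`. -/
def H : Matrix (Fin 5) (Fin 5) K :=
  !![⟨220, 0⟩, ⟨60, -12⟩, ⟨0, -37⟩, ⟨48, 97⟩, ⟨-30, -79⟩;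
     ⟨72, 12⟩, ⟨22, 0⟩, ⟨6, -10⟩, ⟨0, 29⟩, ⟨3, -23⟩;
     ⟨37, 37⟩, ⟨16, 10⟩, ⟨19, 0⟩, ⟨-41, 8⟩, ⟨35, -5⟩;
     ⟨-49, -97⟩, ⟨-29, -29⟩, ⟨-49, -8⟩, ⟨118, 0⟩, ⟨-98, -4⟩;
     ⟨49, 79⟩, ⟨26, 23⟩, ⟨40, 5⟩, ⟨-94, 4⟩, ⟨79, 0⟩]

lemma one_div_one_add_two_mul_ν : 1 / (1 + 2 * ν) = φ ⟨-1 / 11, -2 / 11⟩ := by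
  have h : (1 + 2 * ν) * φ ⟨-1 / 11, -2 / 11⟩ = 1 := by
    simp only [φ_apply]
    push_cast
    linear_combination (-4 / 11) * ν_mul_self
  exact (eq_one_div_of_mul_eq_one_right h).symm

lemma U_eq : U = V * S.map φ := by
  ext i j
  fin_cases j <;>
    simp [U, V, S, Matrix.mul_apply, Fin.sum_univ_five, u₁, u₂, one_div_one_add_two_mul_ν,
      φ_apply, -one_div] <;> ring

lemma conjTranspose_V_mul_V :
    Vᴴ * V = (of fun a b : Fin 5 => period (10 * a + b)).map φ := by
  ext a b
  simp only [mul_apply, conjTranspose_apply, V, of_apply, map_apply, v, ← sum_ξ_pow]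
  refine Finset.sum_congr rfl fun i _ => ?_
  rw [star_pow, ← starRingEnd_apply, conj_ξ, ← pow_mul, ← pow_add]
  congr 1
  ring

lemma conjTranspose_map {m n : Type*} (A : Matrix m n K) : (A.map φ)ᴴ = Aᴴ.map φ := by
  ext i j
  simp [φ_star]

lemma H_mul_gram :
    H * (Sᴴ * (of fun a b : Fin 5 => period (10 * a + b)) * S) = 1 := by
  decide +kernel

lemma conjTranspose_H : Hᴴ = H := by
  decide +kernel

lemma H_mul_U : H.map φ * Uᴴ * U = 1 := by
  have h := congrArg (fun A : Matrix (Fin 5) (Fin 5) K => A.map φ) H_mul_gram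
  simp only [Matrix.map_mul, ← conjTranspose_map, ← conjTranspose_V_mul_V,
    Matrix.map_one φ (map_zero φ) (map_one φ)] at h
  rw [U_eq, conjTranspose_mul, ← h]
  simp only [Matrix.mul_assoc]

lemma U_inv : U⁻¹ = H.map φ * Uᴴ := inv_eq_left_inv H_mul_U

lemma U_inv_mul_conjTranspose : U⁻¹ * U⁻¹ᴴ = H.map φ := by
  conv_lhs => rw [U_inv]
  rw [conjTranspose_mul, conjTranspose_conjTranspose, conjTranspose_map, conjTranspose_H,
    ← Matrix.mul_assoc, H_mul_U, Matrix.one_mul]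

/-- The coordinates of `L p.1 p.2` with respect to `y₁, …, y₅`. -/
def C : Matrix (Fin 5 × Fin 5) (Fin 5) K :=
  of fun p => if p.1 = p.2 then Pi.single p.1 1
    else if p.1 < p.2 then Pi.single p.1 1 + Pi.single p.2 1
    else Pi.single p.2 1 + Pi.single p.1 ⟨0, 1⟩

lemma L_eq (p : Fin 5 × Fin 5) : L p.1 p.2 = (C.map φ * U⁻¹) p := by
  have h1 : φ ⟨0, 1⟩ = ν := by simp [φ_apply]
  ext i
  unfold L y
  split_ifs with h h' <;>
    simp [C, *, Matrix.mul_apply, Pi.single_apply, apply_ite φ, add_mul, Finset.sum_add_distrib]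

lemma herm_L (p q : Fin 5 × Fin 5) :
    herm (L p.1 p.2) (L q.1 q.2) = φ ((C * H * Cᴴ) p q) := by
  have h : herm (L p.1 p.2) (L q.1 q.2) = ((C.map φ * U⁻¹) * (C.map φ * U⁻¹)ᴴ) p q := by
    rw [L_eq, L_eq]
    rfl
  rw [h, conjTranspose_mul, conjTranspose_map, Matrix.mul_assoc, ← Matrix.mul_assoc U⁻¹,
    U_inv_mul_conjTranspose, ← Matrix.map_mul, ← Matrix.map_mul, map_apply, Matrix.mul_assoc]

/-- The matrix of intersection numbers of the 25 classes, in lexicographic order. -/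
def M : Matrix (Fin 25) (Fin 25) ℤ :=
  of fun i j => (([
    [0, 88, 73, 85, 127, 264, 88, 117, 261, 127, 219, 439, 73, 116, 272, 255, 211, 261, 85, 128,
     381, 733, 473, 519, 127],
    [88, 0, 315, 226, 557, 440, 88, 183, 446, 337, 307, 835, 161, 205, 787, 1228, 436, 897, 248,
     205, 637, 1693, 1165, 1515, 359],
    [73, 315, 0, 312, 183, 491, 132, 95, 469, 165, 365, 483, 73, 192, 345, 833, 645, 387, 179,
     165, 516, 927, 776, 904, 191],
    [85, 226, 312, 0, 377, 281, 139, 267, 222, 301, 318, 724, 132, 122, 476, 425, 175, 319, 85,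
     185, 548, 1129, 690, 798, 196],
    [127, 557, 183, 377, 0, 657, 183, 189, 546, 63, 425, 561, 90, 213, 251, 795, 723, 453, 159,
     195, 635, 792, 465, 822, 127],
    [264, 440, 491, 281, 657, 0, 88, 249, 39, 415, 219, 373, 73, 107, 347, 1173, 535, 561, 127,
     95, 189, 607, 470, 501, 151],
    [88, 88, 132, 139, 183, 88, 0, 22, 73, 73, 22, 66, 22, 29, 161, 571, 219, 285, 73, 11, 43,
     219, 197, 354, 73],
    [117, 183, 95, 267, 189, 249, 22, 0, 216, 74, 117, 110, 22, 86, 204, 873, 437, 381, 129, 36,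
     144, 378, 368, 618, 117],
    [261, 446, 469, 222, 546, 39, 73, 216, 0, 330, 165, 279, 62, 54, 294, 921, 365, 382, 73, 60,
     144, 443, 340, 435, 122],
    [127, 337, 165, 301, 63, 415, 73, 74, 330, 0, 175, 233, 49, 110, 170, 859, 549, 447, 135,
     86, 277, 365, 233, 547, 73],
    [219, 307, 365, 318, 425, 219, 22, 117, 165, 175, 0, 175, 73, 29, 398, 1275, 550, 678, 154,
     32, 96, 415, 380, 690, 142],
    [439, 835, 483, 724, 561, 373, 66, 110, 279, 233, 175, 0, 22, 122, 269, 2191, 1194, 849,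
     238, 20, 61, 177, 368, 822, 142],
    [73, 161, 73, 132, 90, 73, 22, 22, 62, 49, 73, 22, 0, 41, 26, 352, 217, 123, 41, 14, 40, 61,
     78, 140, 26],
    [116, 205, 192, 122, 213, 107, 29, 86, 54, 110, 29, 122, 41, 0, 196, 449, 182, 205, 41, 22,
     80, 221, 196, 294, 68],
    [272, 787, 345, 476, 251, 347, 161, 204, 294, 170, 398, 269, 26, 196, 0, 1139, 893, 426,
     137, 130, 302, 209, 130, 237, 26],
    [255, 1228, 833, 425, 795, 1173, 571, 873, 921, 859, 1275, 2191, 352, 449, 1139, 0, 424,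
     381, 85, 608, 1896, 3196, 1919, 1707, 535],
    [211, 436, 645, 175, 723, 535, 219, 437, 365, 549, 550, 1194, 217, 182, 893, 424, 0, 435,
     73, 275, 931, 2031, 1262, 1410, 403],
    [261, 897, 387, 319, 453, 561, 285, 381, 382, 447, 678, 849, 123, 205, 426, 381, 435, 0, 41,
     249, 810, 1245, 897, 835, 233],
    [85, 248, 179, 85, 159, 127, 73, 129, 73, 135, 154, 238, 41, 41, 137, 85, 73, 41, 0, 62,
     199, 325, 199, 186, 62],
    [128, 205, 165, 185, 195, 95, 11, 36, 60, 86, 32, 20, 14, 22, 130, 608, 275, 249, 62, 0, 20,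
     119, 151, 310, 62],
    [381, 637, 516, 548, 635, 189, 43, 144, 144, 277, 96, 61, 40, 80, 302, 1896, 931, 810, 199,
     20, 0, 211, 326, 612, 127],
    [733, 1693, 927, 1129, 792, 607, 219, 378, 443, 365, 415, 177, 61, 221, 209, 3196, 2031,
     1245, 325, 119, 211, 0, 182, 645, 73],
    [473, 1165, 776, 690, 465, 470, 197, 368, 340, 233, 380, 368, 78, 196, 130, 1919, 1262, 897,
     199, 151, 326, 182, 0, 358, 26],
    [519, 1515, 904, 798, 822, 501, 354, 618, 435, 547, 690, 822, 140, 294, 237, 1707, 1410,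
     835, 186, 310, 612, 645, 358, 0, 62],
    [127, 359, 191, 196, 127, 151, 73, 117, 122, 73, 142, 142, 26, 68, 26, 535, 403, 233, 62,
     62, 127, 73, 26, 62, 0]] : List (List ℤ)).getD i []).getD j 0

lemma Q_L (p q : Fin 5 × Fin 5) :
    Q (L p.1 p.2) (L q.1 q.2) = (M (finProdFinEquiv p) (finProdFinEquiv q) : ℝ) := by
  have key : ∀ p q : Fin 5 × Fin 5,
      (C * H * Cᴴ) p p * (C * H * Cᴴ) q q - (C * H * Cᴴ) p q * (C * H * Cᴴ) q p
        = ⟨M (finProdFinEquiv p) (finProdFinEquiv q), 0⟩ := by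
    decide +kernel
  simp only [Q, herm_L, ← map_mul, ← map_sub, key, φ_re]
  simp

/-- A lower triangular matrix which brings `M`, with its first two rows exchanged,
into upper triangular form. -/
def E : Matrix (Fin 25) (Fin 25) ℤ :=
  of fun i j => (([
    [1],
    [0, 1],
    [-73, -315, 88],
    [-2754509, -5411385, -1391896, 4047120],
    [224257394, -707729967, -1802381433, -950460136, 1516758311],
    [-252730996790, 885460622327, -205042016358, -394463453576, -121852914710, 326564805431],
    [-32213704708830, 70322621016933, -7918321417028, 3959746920360, -13778834663924,
     -9888569836533, 84508629872188],
    [-2624092179682, 14108264344291, -13093604927568, 2057995610264, -2624168673368,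
     2287617786321, -34522011709484, 32299991461672],
    [10082325426414, 1033698913998, 4979240841949, -14219898165363, -383640626732,
     -17045528983716, -22936233863459, -8045659758081, 28607030299023],
    [11120720768068, -7320929576903, 4301103233449, -7007650159389, -16469136912382,
     -1314334820977, -62741831363853, -610151044349, 12994639886129, 31044715767362],
    [25001629532953, -30058225349261, -24444910851713, 34285551828, 564089343587,
     10728471172103, -237821953237698, 90189492143674, -727176929974, -649467151465,
     33451606832721],
    [47189309798399, -55993957897483, 13830589306121, 449045290764, -191238934619,
     -18100965184031, -56801963044494, -75623599201738, -696829284122, 94673513425,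
     -16002925398777, 39005704887840],
    [-113751266203162, 20751349827487, 94739919379754, 117503003596, 153668993918,
     -36781456783477, 674304339393082, -219321775956404, 124345521344, -847201772978,
     100187711466700, -217698432493960, 723293254828870],
    [20376418083070, -20598488626335, -16511793110450, 14298181025128, -257849163990,
     29825676057253, -12025767679290, -19241761992068, -70089749823852, 358186620770,
     -47261237615108, 31089462889496, -4807189814526, 77293185181432],
    [-1887539424108, -502017587377, 1367038511586, -93212867737, 2069242780583, -3371894969679,
     18405257671436, 399508765074, 380908691163, -8249545213305, 3497002900402, -4234656644788,
     -3657263009638, -357067402153, 5092131301169],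
    [-2137029771488, -12422230574172, 1056365261446, 3832581779818, -355811658312,
     5053631491081, 35372278496, 5607882677914, -6804997923757, 1308837143020, 6232123235272,
     -1034951420118, -5182920603718, -11435337580183, -767764053441, 1764877840825],
    [-32139465504432, 67132938323275, 702305293140, -6581160646115, 1877016431455,
     2879399717040, 17808933884130, 12257971262224, 4536480396954, -7372645001425,
     8447077207536, -5016066757756, -20277166390072, -11992622801742, 4489043099310,
     -12513121098181, 20294518386802],
    [-402206302116, 11507903759405, -3993547775844, -2281053178525, -99416117515, 710695258806,
     -7057678862554, 2214484425648, 51022254712, 395557931065, -6879763088, 1304658131568,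
     -4500666535948, 770239619864, -245503120720, -2153957194697, 1069434009094, 2691920783596],
    [524278149, -528794538, 1792781265, 701486544, 5965740, 1274111430, 77424055, -827088975,
     -3159533690, -23682065, 121626813, -44201747, -1014917676, -1888923498, 13882110,
     -1695485253, 27674648, -1038310383, 15571152379],
    [6107007, -23664279, 3345372, 2556606, -589485, -2811309, -2330293, -2972772, 2801054,
     858590, -195717, -741386, 1766035, -937103, 621000, 5529378, -4141855, -1928027, -12631083,
     5866195],
    [-1176996, 26581047, -6252993, -5087312, 2470465, 1025781, -27021768, -3808827, 2691384,
     5587215, -7116098, 5943663, 12538187, 4885013, -9197890, -5821571, 6056739, 3615404,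
     -2116236, -12918795, 7571810],
    [88460322, -58311255, -11537217, -7071228, -13851045, -31771785, -158940742, -7930143,
     13107148, -25885025, -8592736, 8717883, 75063417, -731885, -33516890, 1501689, -4984443,
     7126218, -21555490, 22888855, -53578710, 52507420],
    [4646592, -12495705, 5416302, 979089, -2569665, -3906684, 12354492, -8156061, 1050675,
     -3285525, -4213812, 1143261, 5462545, 2269608, -3281685, 3189408, -2138226, -235488,
     -12179805, 4721310, -4095870, 1067955, 4312495],
    [-67632, -51723, -80214, 99939, 164973, 65244, 207476, 76377, -142935, -77439, -6076, 38519,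
     53251, -40328, -73391, -39504, -8230, 16848, 120665, 29978, 52614, -84247, -35363, 80944],
    [-810, 2556, -1293, -516, 249, -135, -57, 1341, 699, -516, -45, 372, 1081, -72, -723, 123,
     243, 87, -1398, -288, 333, -405, -731, -345, 5217]] : List (List ℤ)).getD i []).getD j 0

lemma det_M : M.det = 2 ^ 2 * 11 ^ 10 := by
  have hE : E.det = ∏ i, E i i := det_of_isLowerTriangular E (by
    have : ∀ j i : Fin 25, i < j → E i j = 0 := by decide +kernel
    exact fun i j h => this j i h)
  have hEM : (E * M.submatrix (Equiv.swap 0 1) id).det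
      = ∏ i, (E * M.submatrix (Equiv.swap 0 1) id) i i := det_of_isUpperTriangular (by
    have : ∀ i j : Fin 25, j < i → (E * M.submatrix (Equiv.swap 0 1) id) i j = 0 := by
      decide +kernel
    exact fun i j h => this i j h)
  have h0 : ∏ i, E i i ≠ 0 := by decide +kernel
  have h1 : ∏ i, (E * M.submatrix (Equiv.swap 0 1) id) i i
      = (∏ i, E i i) * -(2 ^ 2 * 11 ^ 10) := by decide +kernel
  rw [det_mul, det_permute, hE, h1, Equiv.Perm.sign_swap (by decide)] at hEM
  have := mul_left_cancel₀ h0 hEM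
  simpa using this

end KleinFano

open KleinFano in
/-- U is invertible, and the determinant of the 25×25 real matrix of the
values Q(ℓ,ℓ') over the 25 listed vectors equals 2²·11¹⁰. -/
theorem NS_discriminant :
    IsUnit U.det ∧
    (Matrix.of fun p q : Fin 5 × Fin 5 => Q (L p.1 p.2) (L q.1 q.2)).det
      = 2 ^ 2 * 11 ^ 10 := by
  refine ⟨isUnit_det_of_left_inverse H_mul_U, ?_⟩
  have h : (Matrix.of fun p q : Fin 5 × Fin 5 => Q (L p.1 p.2) (L q.1 q.2))
      = (M.map (Int.castRingHom ℝ)).submatrix finProdFinEquiv finProdFinEquiv := by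
    ext p q
    simp [Q_L]
  rw [h, det_submatrix_equiv_self, ← RingHom.mapMatrix_apply, ← RingHom.map_det, det_M]
  norm_num
end
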